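/- arXiv:2201.08025 — 3 statements merged into one kernel-verified Lean document; each statement's English description precedes it below -/
import Mathlib

section
/- Let l : ℝ^d → ℝ be differentiable and α-Lipschitz continuous with respect to the Euclidean norm, let σ > 0, and let Z ∼ N(0, σ²I_d). Then the gradient of the smoothed function l_μ(θ) = E[l(θ + Z)] satisfies, for all x, y ∈ ℝ^d, ‖∇l_μ(x) − ∇l_μ(y)‖ ≤ (√2 α / (σ√π)) ‖x − y‖; in particular l_μ is (α/σ)-smooth, i.e. ∇l_μ is (α/σ)-Lipschitz. -/
open MeasureTheory Real

/-- Density of the centered Gaussian measure `N(0, σ²I_d)` on `ℝ^d`. -/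
noncomputable def gaussDensity (d : ℕ) (σ : ℝ) (z : EuclideanSpace ℝ (Fin d)) : ℝ :=
  (2 * π * σ ^ 2) ^ (-(d : ℝ) / 2) * Real.exp (-‖z‖ ^ 2 / (2 * σ ^ 2))

/-- The Gaussian-smoothed version of `l`: `l_μ(θ) = E_{Z ∼ N(0,σ²I_d)}[l(θ + Z)]`. -/
noncomputable def smoothed (d : ℕ) (σ : ℝ) (l : EuclideanSpace ℝ (Fin d) → ℝ)
    (θ : EuclideanSpace ℝ (Fin d)) : ℝ :=
  ∫ z, l (θ + z) * gaussDensity d σ z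

/-- The `L¹` modulus of continuity of a `C¹` function under translation by `v` is bounded by the
`L¹` norm of its derivative in direction `v`. -/
lemma lintegral_enorm_add_sub_le {E : Type*} [NormedAddCommGroup E] [NormedSpace ℝ E]
    [FiniteDimensional ℝ E] [MeasurableSpace E] [BorelSpace E] (μ : Measure E)
    [SFinite μ] [μ.IsAddRightInvariant] {f : E → ℝ} (hf : ContDiff ℝ 1 f) (v : E) :
    ∫⁻ z, ‖f (z + v) - f z‖ₑ ∂μ ≤ ∫⁻ z, ‖fderiv ℝ f z v‖ₑ ∂μ := by
  have hcont : Continuous fun q : E × ℝ => fderiv ℝ f (q.1 + q.2 • v) v :=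
    ((hf.continuous_fderiv one_ne_zero).comp (by fun_prop)).clm_apply continuous_const
  have hftc (z : E) : f (z + v) - f z = ∫ t in (0 : ℝ)..1, fderiv ℝ f (z + t • v) v := by
    have hderiv (t : ℝ) :
        HasDerivAt (fun t : ℝ => f (z + t • v)) (fderiv ℝ f (z + t • v) v) t := by
      have hline : HasDerivAt (fun t : ℝ => z + t • v) v t := by
        simpa using ((hasDerivAt_id t).smul_const v).const_add z
      exact ((hf.differentiable one_ne_zero) _).hasFDerivAt.comp_hasDerivAt t hline
    rw [intervalIntegral.integral_eq_sub_of_hasDerivAt (fun t _ => hderiv t)]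
    · simp
    · exact (hcont.comp (by fun_prop : Continuous fun t : ℝ => (z, t))).intervalIntegrable _ _
  calc ∫⁻ z, ‖f (z + v) - f z‖ₑ ∂μ
      ≤ ∫⁻ z, (∫⁻ t in Set.Ioc (0 : ℝ) 1, ‖fderiv ℝ f (z + t • v) v‖ₑ) ∂μ := by
        refine lintegral_mono fun z => ?_
        rw [hftc z, intervalIntegral.integral_of_le zero_le_one]
        exact enorm_integral_le_lintegral_enorm _
    _ = ∫⁻ t in Set.Ioc (0 : ℝ) 1, ∫⁻ z, ‖fderiv ℝ f (z + t • v) v‖ₑ ∂μ :=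
        lintegral_lintegral_swap hcont.enorm.measurable.aemeasurable
    _ = ∫⁻ _ in Set.Ioc (0 : ℝ) 1, ∫⁻ z, ‖fderiv ℝ f z v‖ₑ ∂μ := by
        refine lintegral_congr fun t => ?_
        exact lintegral_add_right_eq_self (fun z => ‖fderiv ℝ f z v‖ₑ) (t • v)
    _ = ∫⁻ z, ‖fderiv ℝ f z v‖ₑ ∂μ := by simp

lemma gaussDensity_nonneg (d : ℕ) (σ : ℝ) (z : EuclideanSpace ℝ (Fin d)) :
    0 ≤ gaussDensity d σ z := by
  unfold gaussDensity; positivity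

lemma contDiff_gaussDensity (d : ℕ) (σ : ℝ) : ContDiff ℝ 1 (gaussDensity d σ) := by
  unfold gaussDensity
  exact contDiff_const.mul (((contDiff_norm_sq ℝ).neg.div_const _).exp)

lemma fderiv_gaussDensity (d : ℕ) {σ : ℝ} (hσ : σ ≠ 0) (z v : EuclideanSpace ℝ (Fin d)) :
    fderiv ℝ (gaussDensity d σ) z v = -(inner ℝ z v / σ ^ 2) * gaussDensity d σ z := by
  have h : HasFDerivAt (gaussDensity d σ) _ z :=
    ((((hasStrictFDerivAt_norm_sq z).hasFDerivAt.neg.mul_const (2 * σ ^ 2)⁻¹).exp).const_mul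
      ((2 * π * σ ^ 2) ^ (-(d : ℝ) / 2)))
  rw [h.fderiv]
  simp [gaussDensity, div_eq_mul_inv]
  field_simp

lemma integrable_exp_neg_mul_norm_sq {V : Type*} [NormedAddCommGroup V] [InnerProductSpace ℝ V]
    [FiniteDimensional ℝ V] [MeasurableSpace V] [BorelSpace V] {b : ℝ} (hb : 0 < b) :
    Integrable fun z : V => exp (-b * ‖z‖ ^ 2) := by
  have h := (GaussianFourier.integrable_cexp_neg_mul_sq_norm_add
    (show 0 < (b : ℂ).re from hb) 0 (0 : V)).norm
  simpa [Complex.norm_exp, ← Complex.ofReal_pow] using h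

lemma integrable_gaussDensity (d : ℕ) {σ : ℝ} (hσ : 0 < σ) : Integrable (gaussDensity d σ) := by
  have h := (integrable_exp_neg_mul_norm_sq (V := EuclideanSpace ℝ (Fin d))
    (b := (2 * σ ^ 2)⁻¹) (by positivity)).const_mul ((2 * π * σ ^ 2) ^ (-(d : ℝ) / 2))
  refine h.congr (.of_forall fun z => ?_)
  simp only [gaussDensity]
  congr 2
  ring

lemma integrable_norm_mul_gaussDensity (d : ℕ) {σ : ℝ} (hσ : 0 < σ) :
    Integrable fun z => ‖z‖ * gaussDensity d σ z := by
  have h := (integrable_exp_neg_mul_norm_sq (V := EuclideanSpace ℝ (Fin d))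
    (b := (4 * σ ^ 2)⁻¹) (by positivity)).const_mul ((2 * π * σ ^ 2) ^ (-(d : ℝ) / 2) * σ)
  refine h.mono'
    (continuous_norm.mul (contDiff_gaussDensity d σ).continuous).aestronglyMeasurable
    (.of_forall fun z => ?_)
  rw [norm_of_nonneg (mul_nonneg (norm_nonneg _) (gaussDensity_nonneg _ _ _))]
  have hle : ‖z‖ ≤ σ * exp (‖z‖ ^ 2 / (4 * σ ^ 2)) := by
    have h1 : ‖z‖ ≤ σ * (‖z‖ ^ 2 / (4 * σ ^ 2) + 1) := by
      have : σ * (‖z‖ ^ 2 / (4 * σ ^ 2) + 1) - ‖z‖ = (‖z‖ - 2 * σ) ^ 2 / (4 * σ) := by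
        field_simp; ring
      have : 0 ≤ (‖z‖ - 2 * σ) ^ 2 / (4 * σ) := by positivity
      linarith
    exact h1.trans (mul_le_mul_of_nonneg_left (add_one_le_exp _) hσ.le)
  calc ‖z‖ * gaussDensity d σ z
      ≤ σ * exp (‖z‖ ^ 2 / (4 * σ ^ 2)) * gaussDensity d σ z :=
        mul_le_mul_of_nonneg_right hle (gaussDensity_nonneg _ _ _)
    _ = (2 * π * σ ^ 2) ^ (-(d : ℝ) / 2) * σ *
          (exp (‖z‖ ^ 2 / (4 * σ ^ 2)) * exp (-‖z‖ ^ 2 / (2 * σ ^ 2))) := by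
        rw [gaussDensity]; ring
    _ = _ := by
        rw [← exp_add]
        congr 2
        field_simp
        ring

lemma integral_abs_mul_exp_neg_mul_sq {b : ℝ} (hb : 0 < b) :
    ∫ x : ℝ, |x| * exp (-b * x ^ 2) = b⁻¹ := by
  have h := integral_rpow_mul_exp_neg_mul_rpow (p := 2) (q := 1) two_pos (by norm_num) hb
  have h2 := integral_comp_abs (f := fun x => x * exp (-b * x ^ 2))
  simp only [sq_abs] at h2
  rw [h2]
  norm_num [rpow_neg_one] at h
  rw [show (fun x : ℝ => x * exp (-b * x ^ 2)) = fun x : ℝ => x * exp (-(b * x ^ 2)) by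
    simp, h]
  ring

lemma gaussDensity_eq_prod (d : ℕ) {σ : ℝ} (z : EuclideanSpace ℝ (Fin d)) :
    gaussDensity d σ z = ∏ i, (√(2 * π * σ ^ 2))⁻¹ * exp (-(2 * σ ^ 2)⁻¹ * z i ^ 2) := by
  rw [Finset.prod_mul_distrib, ← exp_sum, ← Finset.mul_sum, Finset.prod_const,
    ← EuclideanSpace.real_norm_sq_eq, gaussDensity, Finset.card_univ, Fintype.card_fin]
  congr 1
  · rw [sqrt_eq_rpow, ← rpow_neg (by positivity), ← rpow_mul_natCast (by positivity)]
    congr 1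
    ring
  · congr 1
    ring

lemma integral_abs_coord_mul_gaussDensity {d : ℕ} {σ : ℝ} (hσ : 0 < σ) (i : Fin d) :
    ∫ z : EuclideanSpace ℝ (Fin d), |z i| * gaussDensity d σ z = σ * √2 / √π := by
  have hsq : √(2 * π * σ ^ 2) = √2 * √π * σ := by
    rw [sqrt_mul (by positivity), sqrt_mul (by positivity), sqrt_sq hσ.le]
  have h2 : √2 * √2 = (2 : ℝ) := mul_self_sqrt zero_le_two
  have hπ : 0 < √π := sqrt_pos.2 pi_pos
  let φ : ℝ → ℝ := fun x => (√(2 * π * σ ^ 2))⁻¹ * exp (-(2 * σ ^ 2)⁻¹ * x ^ 2)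
  have hφ : ∫ x, φ x = 1 := by
    simp only [φ]
    rw [integral_const_mul, integral_gaussian, div_inv_eq_mul,
      show π * (2 * σ ^ 2) = 2 * π * σ ^ 2 by ring]
    exact inv_mul_cancel₀ (by rw [hsq]; positivity)
  have hφabs : ∫ x, |x| * φ x = σ * √2 / √π := by
    simp only [φ, mul_left_comm |_|]
    rw [integral_const_mul, integral_abs_mul_exp_neg_mul_sq (by positivity), inv_inv, hsq]
    field_simp
    nlinarith [h2]
  rw [← (PiLp.volume_preserving_toLp (Fin d)).integral_comp
    (MeasurableEquiv.toLp 2 _).measurableEmbedding]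
  have hprod (x : Fin d → ℝ) : |x i| * ∏ j, φ (x j) =
      ∏ j, (if j = i then |x j| * φ (x j) else φ (x j)) := by
    rw [← Finset.mul_prod_erase _ (fun j => φ (x j)) (Finset.mem_univ i),
      ← Finset.mul_prod_erase _ (fun j => if j = i then |x j| * φ (x j) else φ (x j))
        (Finset.mem_univ i),
      if_pos rfl]
    have herase : ∏ j ∈ Finset.univ.erase i, (if j = i then |x j| * φ (x j) else φ (x j)) =
        ∏ j ∈ Finset.univ.erase i, φ (x j) :=
      Finset.prod_congr rfl fun j hj => if_neg (Finset.ne_of_mem_erase hj)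
    rw [herase]
    exact (mul_assoc _ _ _).symm
  simp only [gaussDensity_eq_prod]
  calc _ = ∫ x : Fin d → ℝ, ∏ j, (if j = i then |x j| * φ (x j) else φ (x j)) :=
        integral_congr_ae (.of_forall fun x => hprod x)
    _ = ∏ j, ∫ x : ℝ, if j = i then |x| * φ x else φ x :=
        integral_fintype_prod_volume_eq_prod
          (fun j x => if j = i then |x| * φ x else φ x)
    _ = ∏ j, if j = i then σ * √2 / √π else 1 := by
        refine Finset.prod_congr rfl fun j _ => ?_
        split_ifs
        exacts [hφabs, hφ]
    _ = _ := by simp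

lemma integral_abs_inner_mul_gaussDensity {d : ℕ} {σ : ℝ} (hσ : 0 < σ)
    (v : EuclideanSpace ℝ (Fin d)) :
    ∫ z, |inner ℝ z v| * gaussDensity d σ z = σ * √2 / √π * ‖v‖ := by
  rcases eq_or_ne v 0 with rfl | hv
  · simp
  obtain ⟨i⟩ : Nonempty (Fin d) := by
    by_contra h
    rw [not_nonempty_iff] at h
    exact hv (Subsingleton.elim _ _)
  obtain ⟨b, hb⟩ := Orthonormal.exists_orthonormalBasis_extension_of_card_eq
    (𝕜 := ℝ) (E := EuclideanSpace ℝ (Fin d)) (ι := Fin d) (by simp)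
    (v := fun _ => ‖v‖⁻¹ • v) (s := {i})
    ⟨fun _ => by simp [norm_smul, hv], fun j k hjk => (hjk (Subsingleton.elim _ _)).elim⟩
  have hvb : v = ‖v‖ • b i := by
    rw [hb i rfl, smul_inv_smul₀ (norm_ne_zero_iff.2 hv)]
  have hinner (z : EuclideanSpace ℝ (Fin d)) : |inner ℝ z v| * gaussDensity d σ z =
      ‖v‖ * (|b.repr z i| * gaussDensity d σ (b.repr z)) := by
    have hg : gaussDensity d σ (b.repr z) = gaussDensity d σ z := by
      simp only [gaussDensity, LinearIsometryEquiv.norm_map]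
    rw [hg, b.repr_apply_apply, real_inner_comm]
    conv_lhs => rw [hvb, real_inner_smul_left, abs_mul, abs_norm]
    ring
  simp only [hinner]
  rw [integral_const_mul, b.measurePreserving_repr.integral_comp
    b.repr.toHomeomorph.measurableEmbedding (fun z => |z i| * gaussDensity d σ z),
    integral_abs_coord_mul_gaussDensity hσ, mul_comm]

/-- Twice the total variation distance between two translates of `N(0, σ²I_d)`. -/
lemma integral_abs_gaussDensity_sub_le {d : ℕ} {σ : ℝ} (hσ : 0 < σ)
    (x y : EuclideanSpace ℝ (Fin d)) :
    ∫ z, |gaussDensity d σ (z - x) - gaussDensity d σ (z - y)| ≤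
      √2 / (σ * √π) * ‖x - y‖ := by
  have hint : Integrable fun z => fderiv ℝ (gaussDensity d σ) z (y - x) := by
    refine ((integrable_norm_mul_gaussDensity d hσ).const_mul (‖y - x‖ / σ ^ 2)).mono'
      ((((contDiff_gaussDensity d σ).continuous_fderiv one_ne_zero).clm_apply
        continuous_const).aestronglyMeasurable) (.of_forall fun z => ?_)
    rw [fderiv_gaussDensity d hσ.ne', norm_mul, norm_neg, norm_div,
      norm_of_nonneg (gaussDensity_nonneg _ _ _), norm_of_nonneg (sq_nonneg σ)]
    calc _ ≤ ‖z‖ * ‖y - x‖ / σ ^ 2 * gaussDensity d σ z := by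
          gcongr
          · exact gaussDensity_nonneg _ _ _
          · exact norm_inner_le_norm _ _
      _ = _ := by ring
  have hnorm : ∫ z, ‖fderiv ℝ (gaussDensity d σ) z (y - x)‖ = √2 / (σ * √π) * ‖x - y‖ := by
    have h (z : EuclideanSpace ℝ (Fin d)) : ‖fderiv ℝ (gaussDensity d σ) z (y - x)‖ =
        (σ ^ 2)⁻¹ * (|inner ℝ z (y - x)| * gaussDensity d σ z) := by
      rw [fderiv_gaussDensity d hσ.ne', norm_mul, norm_neg, norm_div,
        norm_of_nonneg (gaussDensity_nonneg _ _ _), norm_of_nonneg (sq_nonneg σ), norm_eq_abs]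
      ring
    simp only [h]
    rw [integral_const_mul, integral_abs_inner_mul_gaussDensity hσ, norm_sub_rev]
    field_simp
  have hsub : Integrable fun z => gaussDensity d σ (z + (y - x)) - gaussDensity d σ z :=
    ((integrable_gaussDensity d hσ).comp_add_right _).sub (integrable_gaussDensity d hσ)
  have hL1 := lintegral_enorm_add_sub_le volume (contDiff_gaussDensity d σ) (y - x)
  rw [← ofReal_integral_norm_eq_lintegral_enorm hint, hnorm,
    ← ofReal_integral_norm_eq_lintegral_enorm hsub,
    ENNReal.ofReal_le_ofReal_iff (by positivity)] at hL1
  refine le_trans (le_of_eq ?_) hL1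
  rw [← integral_sub_right_eq_self (fun z => ‖gaussDensity d σ (z + (y - x)) -
    gaussDensity d σ z‖) y]
  simp [norm_eq_abs]

lemma hasFDerivAt_smoothed {d : ℕ} {α σ : ℝ} (hσ : 0 < σ)
    {l : EuclideanSpace ℝ (Fin d) → ℝ} (hdiff : Differentiable ℝ l)
    (hlip : ∀ x y, |l x - l y| ≤ α * ‖x - y‖) (θ : EuclideanSpace ℝ (Fin d)) :
    Integrable (fun z => gaussDensity d σ z • fderiv ℝ l (θ + z)) ∧
      HasFDerivAt (smoothed d σ l) (∫ z, gaussDensity d σ z • fderiv ℝ l (θ + z)) θ := by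
  have hp := (contDiff_gaussDensity d σ).continuous
  have hmeas (x : EuclideanSpace ℝ (Fin d)) :
      AEStronglyMeasurable (fun z => l (x + z) * gaussDensity d σ z) :=
    ((hdiff.continuous.comp (by fun_prop)).mul hp).aestronglyMeasurable
  refine hasFDerivAt_integral_of_dominated_loc_of_lip' (s := Set.univ)
    (bound := fun z => α * gaussDensity d σ z) Filter.univ_mem (fun x _ => hmeas x) ?_ ?_ ?_
    ((integrable_gaussDensity d hσ).const_mul α) ?_
  · refine (((integrable_gaussDensity d hσ).const_mul |l θ|).add
      ((integrable_norm_mul_gaussDensity d hσ).const_mul α)).mono' (hmeas θ)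
      (.of_forall fun z => ?_)
    rw [norm_mul, norm_of_nonneg (gaussDensity_nonneg _ _ _), norm_eq_abs]
    have h1 : |l (θ + z)| ≤ |l θ| + α * ‖z‖ := by
      have h2 := hlip (θ + z) θ
      rw [add_sub_cancel_left] at h2
      linarith [abs_sub_abs_le_abs_sub (l (θ + z)) (l θ)]
    calc _ ≤ (|l θ| + α * ‖z‖) * gaussDensity d σ z :=
          mul_le_mul_of_nonneg_right h1 (gaussDensity_nonneg _ _ _)
      _ = _ := by simp only [Pi.add_apply]; ring
  · exact (hp.measurable.smul
      ((measurable_fderiv ℝ l).comp (measurable_const_add θ))).aestronglyMeasurable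
  · refine .of_forall fun z x _ => ?_
    rw [← sub_mul, norm_mul, norm_of_nonneg (gaussDensity_nonneg _ _ _), norm_eq_abs]
    have h1 := hlip (x + z) (θ + z)
    rw [add_sub_add_right_eq_sub] at h1
    calc _ ≤ α * ‖x - θ‖ * gaussDensity d σ z :=
          mul_le_mul_of_nonneg_right h1 (gaussDensity_nonneg _ _ _)
      _ = _ := by ring
  · refine .of_forall fun z => ?_
    have h1 : HasFDerivAt (fun x => l (x + z)) (fderiv ℝ l (θ + z)) θ :=
      (hasFDerivAt_comp_add_right z).2 (hdiff (θ + z)).hasFDerivAt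
    exact h1.mul_const _

lemma norm_gradient_smoothed_sub_le {d : ℕ} {α σ : ℝ} (hα : 0 ≤ α) (hσ : 0 < σ)
    {l : EuclideanSpace ℝ (Fin d) → ℝ} (hdiff : Differentiable ℝ l)
    (hlip : ∀ x y, |l x - l y| ≤ α * ‖x - y‖) (x y : EuclideanSpace ℝ (Fin d)) :
    ‖gradient (smoothed d σ l) x - gradient (smoothed d σ l) y‖ ≤
      √2 * α / (σ * √π) * ‖x - y‖ := by
  have hnorm (z : EuclideanSpace ℝ (Fin d)) : ‖fderiv ℝ l z‖ ≤ α :=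
    norm_fderiv_le_of_lip' ℝ hα (.of_forall fun w => hlip w z)
  have hfderiv (θ : EuclideanSpace ℝ (Fin d)) :
      Integrable (fun z => gaussDensity d σ (z - θ) • fderiv ℝ l z) ∧
        fderiv ℝ (smoothed d σ l) θ = ∫ z, gaussDensity d σ (z - θ) • fderiv ℝ l z := by
    obtain ⟨hint, hderiv⟩ := hasFDerivAt_smoothed hσ hdiff hlip θ
    refine ⟨by simpa using hint.comp_sub_right θ, ?_⟩
    rw [hderiv.fderiv, ← integral_sub_right_eq_self _ θ]
    simp
  rw [gradient, gradient, ← map_sub, LinearIsometryEquiv.norm_map, (hfderiv x).2, (hfderiv y).2,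
    ← integral_sub (hfderiv x).1 (hfderiv y).1]
  have hp (θ : EuclideanSpace ℝ (Fin d)) : Integrable fun z => gaussDensity d σ (z - θ) :=
    (integrable_gaussDensity d hσ).comp_sub_right θ
  calc _ ≤ ∫ z, α * |gaussDensity d σ (z - x) - gaussDensity d σ (z - y)| := by
        refine norm_integral_le_of_norm_le (((hp x).sub (hp y)).abs.const_mul α)
          (.of_forall fun z => ?_)
        rw [← sub_smul, norm_smul, norm_eq_abs, mul_comm]
        exact mul_le_mul_of_nonneg_right (hnorm z) (abs_nonneg _)
    _ ≤ α * (√2 / (σ * √π) * ‖x - y‖) := by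
        rw [integral_const_mul]
        exact mul_le_mul_of_nonneg_left (integral_abs_gaussDensity_sub_le hσ x y) hα
    _ = _ := by ring

/-- The gradient of the Gaussian smoothing of a differentiable `α`-Lipschitz function is
`(√2 α/(σ√π))`-Lipschitz; in particular `l_μ` is `(α/σ)`-smooth. -/
theorem stmt_4 {d : ℕ} (α σ : ℝ) (hα : 0 < α) (hσ : 0 < σ)
    (l : EuclideanSpace ℝ (Fin d) → ℝ) (hdiff : Differentiable ℝ l)
    (hlip : ∀ x y, |l x - l y| ≤ α * ‖x - y‖) :
    ∀ x y : EuclideanSpace ℝ (Fin d),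
      ‖gradient (smoothed d σ l) x - gradient (smoothed d σ l) y‖ ≤
          Real.sqrt 2 * α / (σ * Real.sqrt π) * ‖x - y‖ ∧
        ‖gradient (smoothed d σ l) x - gradient (smoothed d σ l) y‖ ≤ α / σ * ‖x - y‖ := by
  intro x y
  have h := norm_gradient_smoothed_sub_le hα.le hσ hdiff hlip x y
  refine ⟨h, h.trans (mul_le_mul_of_nonneg_right ?_ (norm_nonneg _))⟩
  have hπ : 0 < √π := sqrt_pos.2 pi_pos
  have h2 : √2 ≤ √π := sqrt_le_sqrt two_le_pi
  rw [div_le_div_iff₀ (by positivity) hσ]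
  calc √2 * α * σ ≤ √π * α * σ := by gcongr
    _ = α * (σ * √π) := by ring
end

section
/- Let l : ℝ^d → ℝ be differentiable and α-Lipschitz continuous with respect to the Euclidean norm, and let Z ∼ N(0, Σ) with diagonal covariance Σ = diag(σ_1², …, σ_d²), all σ_i > 0; set σ_− = min_i σ_i. Then the smoothed function l_μ(θ) = E[l(θ + Z)] has a gradient satisfying ‖∇l_μ(x) − ∇l_μ(y)‖ ≤ (√2 α/(σ_− √π)) ‖x − y‖ ≤ (α/σ_−) ‖x − y‖ for all x, y ∈ ℝ^d; in particular l_μ is (α/σ_−)-smooth. -/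
open MeasureTheory Real

/-- Density of the anisotropic Gaussian `N(0, diag(σ_1², …, σ_d²))` on `ℝ^d`. -/
noncomputable def anisoGaussDensity (d : ℕ) (σ : Fin d → ℝ)
    (z : EuclideanSpace ℝ (Fin d)) : ℝ :=
  ∏ i, (2 * π * σ i ^ 2) ^ (-(1 : ℝ) / 2) * Real.exp (-(z i) ^ 2 / (2 * σ i ^ 2))

/-- The smoothing of `l` by the anisotropic Gaussian `N(0, diag(σ_1², …, σ_d²))`:
`l_μ(θ) = E[l(θ + Z)]`. -/
noncomputable def smoothedAniso (d : ℕ) (σ : Fin d → ℝ)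
    (l : EuclideanSpace ℝ (Fin d) → ℝ) (θ : EuclideanSpace ℝ (Fin d)) : ℝ :=
  ∫ z, l (θ + z) * anisoGaussDensity d σ z

open ProbabilityTheory
open scoped NNReal ENNReal

/-- The `L¹` norm of a difference of translates is at most that of the directional derivative. -/
lemma lintegral_enorm_translate_sub_le {E : Type*} [NormedAddCommGroup E] [NormedSpace ℝ E]
    [MeasurableSpace E] [BorelSpace E] [SecondCountableTopology E]
    (μ : Measure E) [SFinite μ] [μ.IsAddRightInvariant] {f g : E → ℝ} (hg : Continuous g)
    (u : E) (hderiv : ∀ z, ∀ t : ℝ, HasDerivAt (fun s : ℝ ↦ f (z + s • u)) (g (z + t • u)) t) :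
    ∫⁻ z, ‖f (z + u) - f z‖ₑ ∂μ ≤ ∫⁻ z, ‖g z‖ₑ ∂μ := by
  have hpt : ∀ z, ‖f (z + u) - f z‖ₑ ≤ ∫⁻ t : ℝ in Set.Ioc 0 1, ‖g (z + t • u)‖ₑ := by
    intro z
    have hint : IntervalIntegrable (fun t : ℝ ↦ g (z + t • u)) volume 0 1 :=
      Continuous.intervalIntegrable (by fun_prop) _ _
    have h := intervalIntegral.integral_eq_sub_of_hasDerivAt (fun t _ ↦ hderiv z t) hint
    simp only [one_smul, zero_smul, add_zero] at h
    rw [← h, intervalIntegral.integral_of_le zero_le_one]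
    exact enorm_integral_le_lintegral_enorm _
  calc ∫⁻ z, ‖f (z + u) - f z‖ₑ ∂μ
      ≤ ∫⁻ z, (∫⁻ t in Set.Ioc (0 : ℝ) 1, ‖g (z + t • u)‖ₑ) ∂μ := lintegral_mono hpt
    _ = ∫⁻ t in Set.Ioc (0 : ℝ) 1, ∫⁻ z, ‖g (z + t • u)‖ₑ ∂μ := by
        refine lintegral_lintegral_swap ?_
        exact Measurable.aemeasurable (Continuous.measurable (by fun_prop))
    _ = ∫⁻ _ in Set.Ioc (0 : ℝ) 1, ∫⁻ z, ‖g z‖ₑ ∂μ :=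
        lintegral_congr fun t ↦ lintegral_add_right_eq_self (fun z ↦ ‖g z‖ₑ) (t • u)
    _ = ∫⁻ z, ‖g z‖ₑ ∂μ := by simp

/-- The first absolute moment of a centered real Gaussian. -/
lemma integral_abs_gaussianReal (v : ℝ≥0) :
    ∫ x, |x| ∂(gaussianReal 0 v) = √2 / √π * √v := by
  by_cases hv : v = 0
  · simp [hv]
  have hv_pos : (0 : ℝ) < v := by positivity
  rw [integral_gaussianReal_eq_integral_smul hv]
  have h_even : ∀ x : ℝ, gaussianPDFReal 0 v x • |x| =
      (fun y : ℝ ↦ (√(2 * π * v))⁻¹ * (y ^ (1 : ℝ) * exp (-(2 * v : ℝ)⁻¹ * y ^ (2 : ℝ)))) |x| := by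
    intro x
    simp only [gaussianPDFReal, sub_zero, smul_eq_mul, rpow_one, rpow_two, sq_abs]
    rw [show -x ^ 2 / (2 * (v : ℝ)) = -(2 * v : ℝ)⁻¹ * x ^ 2 by ring]
    ring
  simp_rw [h_even]
  rw [integral_comp_abs (f := fun y ↦
    (√(2 * π * v))⁻¹ * (y ^ (1 : ℝ) * exp (-(2 * v : ℝ)⁻¹ * y ^ (2 : ℝ)))), integral_const_mul,
    integral_rpow_mul_exp_neg_mul_rpow two_pos (by norm_num) (by positivity)]
  norm_num
  rw [rpow_neg_one]
  have := Real.sq_sqrt hv_pos.le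
  have := Real.sq_sqrt (zero_le_two (α := ℝ))
  field_simp
  nlinarith

section Density

variable {d : ℕ} {σ : Fin d → ℝ}

lemma anisoGaussDensity_eq_prod_gaussianPDFReal (z : EuclideanSpace ℝ (Fin d)) :
    anisoGaussDensity d σ z = ∏ i, gaussianPDFReal 0 (.mk (σ i ^ 2) (sq_nonneg _)) (z i) := by
  refine Finset.prod_congr rfl fun i _ ↦ ?_
  simp only [gaussianPDFReal, NNReal.coe_mk, sub_zero]
  rw [neg_div, rpow_neg (by positivity), ← sqrt_eq_rpow]

lemma anisoGaussDensity_nonneg (z : EuclideanSpace ℝ (Fin d)) : 0 ≤ anisoGaussDensity d σ z := by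
  rw [anisoGaussDensity_eq_prod_gaussianPDFReal]
  exact Finset.prod_nonneg fun i _ ↦ gaussianPDFReal_nonneg _ _ _

lemma continuous_anisoGaussDensity : Continuous (anisoGaussDensity d σ) := by
  unfold anisoGaussDensity
  fun_prop

lemma integrable_anisoGaussDensity : Integrable (anisoGaussDensity d σ) := by
  rw [← (PiLp.volume_preserving_toLp (Fin d)).integrable_comp_emb
    (MeasurableEquiv.toLp 2 _).measurableEmbedding]
  simp only [Function.comp_def, anisoGaussDensity_eq_prod_gaussianPDFReal]
  exact Integrable.fintype_prod fun i ↦ integrable_gaussianPDFReal _ _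

lemma hasDerivAt_anisoGaussDensity_line (z u : EuclideanSpace ℝ (Fin d)) (t : ℝ) :
    HasDerivAt (fun s : ℝ ↦ anisoGaussDensity d σ (z + s • u))
      (-(∑ i, u i / σ i ^ 2 * (z + t • u) i) * anisoGaussDensity d σ (z + t • u)) t := by
  have hexp : ∀ y, anisoGaussDensity d σ y =
      (∏ i, (2 * π * σ i ^ 2) ^ (-(1 : ℝ) / 2)) * exp (∑ i, -(y i) ^ 2 / (2 * σ i ^ 2)) := by
    intro y
    rw [anisoGaussDensity, Finset.prod_mul_distrib, exp_sum]
  have hquad : HasDerivAt (fun s : ℝ ↦ ∑ i, -((z + s • u) i) ^ 2 / (2 * σ i ^ 2))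
      (-∑ i, u i / σ i ^ 2 * (z + t • u) i) t := by
    rw [← Finset.sum_neg_distrib]
    refine HasDerivAt.fun_sum fun i _ ↦ ?_
    simp only [PiLp.add_apply, PiLp.smul_apply, smul_eq_mul]
    have h := (((((hasDerivAt_id t).mul_const (u i)).const_add (z i)).pow 2).neg).div_const
      (2 * σ i ^ 2)
    refine h.congr_deriv ?_
    simp only [id, Nat.cast_ofNat]
    by_cases hs : σ i = 0
    · simp [hs]
    · field_simp
      ring
  simp_rw [hexp]
  refine (hquad.exp.const_mul _).congr_deriv ?_
  ring

/-- The Gaussian measure with density `anisoGaussDensity`. -/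
noncomputable def anisoGaussMeasure (d : ℕ) (σ : Fin d → ℝ) :
    Measure (EuclideanSpace ℝ (Fin d)) :=
  volume.withDensity fun z ↦ ENNReal.ofReal (anisoGaussDensity d σ z)

instance : IsFiniteMeasure (anisoGaussMeasure d σ) :=
  isFiniteMeasure_withDensity_ofReal integrable_anisoGaussDensity.2

lemma integral_anisoGaussMeasure {F : Type*} [NormedAddCommGroup F] [NormedSpace ℝ F]
    (g : EuclideanSpace ℝ (Fin d) → F) :
    ∫ z, g z ∂(anisoGaussMeasure d σ) = ∫ z, anisoGaussDensity d σ z • g z := by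
  rw [anisoGaussMeasure, integral_withDensity_eq_integral_toReal_smul
    (continuous_anisoGaussDensity.measurable.ennreal_ofReal) (by simp)]
  simp [anisoGaussDensity_nonneg]

lemma integrable_anisoGaussMeasure_iff {F : Type*} [NormedAddCommGroup F] [NormedSpace ℝ F]
    {g : EuclideanSpace ℝ (Fin d) → F} :
    Integrable g (anisoGaussMeasure d σ) ↔
      Integrable fun z ↦ anisoGaussDensity d σ z • g z := by
  rw [anisoGaussMeasure, integrable_withDensity_iff_integrable_smul'
    (continuous_anisoGaussDensity.measurable.ennreal_ofReal) (by simp)]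
  simp [anisoGaussDensity_nonneg]

/-- Linear functionals of an anisotropic Gaussian vector are Gaussian. -/
lemma map_linear_anisoGaussMeasure (hσ : ∀ i, 0 < σ i) (w : Fin d → ℝ) :
    (anisoGaussMeasure d σ).map (fun z ↦ ∑ i, w i * z i) =
      gaussianReal 0 (.mk (∑ i, w i ^ 2 * σ i ^ 2) (by positivity)) := by
  refine Measure.ext_of_charFun (funext fun t ↦ ?_)
  have hm : Measurable fun z : EuclideanSpace ℝ (Fin d) ↦ ∑ i, w i * z i := by fun_prop
  rw [charFun_apply_real, integral_map hm.aemeasurable (by fun_prop), charFun_gaussianReal,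
    integral_anisoGaussMeasure, ← (PiLp.volume_preserving_toLp (Fin d)).integral_comp
    (MeasurableEquiv.toLp 2 _).measurableEmbedding]
  have hprod : ∀ x : Fin d → ℝ, anisoGaussDensity d σ (WithLp.toLp 2 x) •
      Complex.exp (t * (∑ i, w i * x i : ℝ) * Complex.I) =
      ∏ i, gaussianPDFReal 0 (.mk (σ i ^ 2) (sq_nonneg _)) (x i) •
        Complex.exp ((t * w i : ℝ) * x i * Complex.I) := by
    intro x
    simp only [anisoGaussDensity_eq_prod_gaussianPDFReal, Complex.real_smul,
      Finset.prod_mul_distrib, ← Complex.exp_sum]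
    push_cast
    rw [Finset.mul_sum, Finset.sum_mul]
    congr 3 with i
    ring
  simp_rw [hprod]
  rw [integral_fintype_prod_volume_eq_prod (f := fun i (y : ℝ) ↦
    gaussianPDFReal 0 (.mk (σ i ^ 2) (sq_nonneg _)) y • Complex.exp ((t * w i : ℝ) * y * Complex.I))]
  have hfac : ∀ i, ∫ y : ℝ, gaussianPDFReal 0 (.mk (σ i ^ 2) (sq_nonneg _)) y •
      Complex.exp ((t * w i : ℝ) * y * Complex.I) =
      Complex.exp (-((w i ^ 2 * σ i ^ 2 : ℝ) * t ^ 2 / 2)) := by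
    intro i
    have hne : NNReal.mk (σ i ^ 2) (sq_nonneg _) ≠ 0 := by
      intro h
      exact (pow_pos (hσ i) 2).ne' (congrArg NNReal.toReal h)
    rw [← integral_gaussianReal_eq_integral_smul hne, ← charFun_apply_real, charFun_gaussianReal]
    congr 1
    simp
    ring
  simp_rw [hfac, ← Complex.exp_sum]
  congr 1
  simp [Finset.sum_mul, Finset.sum_div]

lemma integrable_linear_anisoGaussMeasure (hσ : ∀ i, 0 < σ i) (w : Fin d → ℝ) :
    Integrable (fun z : EuclideanSpace ℝ (Fin d) ↦ ∑ i, w i * z i) (anisoGaussMeasure d σ) := by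
  have hm : Measurable fun z : EuclideanSpace ℝ (Fin d) ↦ ∑ i, w i * z i := by fun_prop
  refine (integrable_map_measure (g := id) (by fun_prop) hm.aemeasurable).mp ?_
  rw [map_linear_anisoGaussMeasure hσ]
  exact IsGaussian.integrable_id

lemma integral_abs_linear_anisoGaussMeasure (hσ : ∀ i, 0 < σ i) (w : Fin d → ℝ) :
    ∫ z, |∑ i, w i * z i| ∂(anisoGaussMeasure d σ) =
      √2 / √π * √(∑ i, w i ^ 2 * σ i ^ 2) := by
  have hm : Measurable fun z : EuclideanSpace ℝ (Fin d) ↦ ∑ i, w i * z i := by fun_prop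
  rw [← integral_map (f := fun x ↦ |x|) hm.aemeasurable (by fun_prop),
    map_linear_anisoGaussMeasure hσ, integral_abs_gaussianReal]
  rfl

lemma integrable_norm_anisoGaussMeasure (hσ : ∀ i, 0 < σ i) :
    Integrable (fun z ↦ ‖z‖) (anisoGaussMeasure d σ) := by
  have hcoord : ∀ i, Integrable (fun z : EuclideanSpace ℝ (Fin d) ↦ z i)
      (anisoGaussMeasure d σ) := by
    intro i
    simpa [Pi.single_apply] using integrable_linear_anisoGaussMeasure hσ (Pi.single i 1)
  refine (integrable_finsetSum Finset.univ fun i _ ↦ (hcoord i).norm).mono' (by fun_prop)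
    (ae_of_all _ fun z ↦ ?_)
  rw [norm_norm, EuclideanSpace.norm_eq]
  exact sqrt_le_left (Finset.sum_nonneg fun i _ ↦ norm_nonneg _) |>.mpr
    (Finset.sum_sq_le_sq_sum_of_nonneg fun i _ ↦ norm_nonneg _)

/-- Total variation bound between translates of the anisotropic Gaussian. -/
lemma integral_abs_anisoGaussDensity_translate_sub_le (hσ : ∀ i, 0 < σ i)
    (u : EuclideanSpace ℝ (Fin d)) :
    ∫ z, |anisoGaussDensity d σ (z + u) - anisoGaussDensity d σ z| ≤
      √2 / √π * √(∑ i, (u i / σ i) ^ 2) := by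
  have hp := continuous_anisoGaussDensity (d := d) (σ := σ)
  set ψ : EuclideanSpace ℝ (Fin d) → ℝ := fun z ↦ ∑ i, u i / σ i ^ 2 * z i with hψ
  have hle := lintegral_enorm_translate_sub_le volume (f := anisoGaussDensity d σ)
    (g := fun z ↦ -ψ z * anisoGaussDensity d σ z) (by fun_prop) u
    (hasDerivAt_anisoGaussDensity_line · u)
  have hint : Integrable fun z ↦ -ψ z * anisoGaussDensity d σ z := by
    have := integrable_anisoGaussMeasure_iff.mp
      (integrable_linear_anisoGaussMeasure hσ fun i ↦ u i / σ i ^ 2).neg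
    simpa [mul_comm, hψ] using this
  simp_rw [← norm_eq_abs]
  rw [integral_norm_eq_lintegral_enorm (by fun_prop)]
  refine (ENNReal.toReal_mono hint.2.ne hle).trans_eq ?_
  rw [← integral_norm_eq_lintegral_enorm (by fun_prop)]
  have hnorm : ∀ z, ‖-ψ z * anisoGaussDensity d σ z‖ = anisoGaussDensity d σ z • |ψ z| := by
    intro z
    rw [norm_mul, norm_neg, norm_of_nonneg (anisoGaussDensity_nonneg z), smul_eq_mul, mul_comm,
      norm_eq_abs]
  simp_rw [hnorm]
  rw [← integral_anisoGaussMeasure, hψ, integral_abs_linear_anisoGaussMeasure hσ]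
  congr 3 with i
  have := (hσ i).ne'
  field_simp

/-- Differentiation under the integral defining the smoothing of a Lipschitz function. -/
lemma hasFDerivAt_smoothedAniso (hσ : ∀ i, 0 < σ i) {α : ℝ}
    {l : EuclideanSpace ℝ (Fin d) → ℝ} (hdiff : Differentiable ℝ l)
    (hlip : ∀ x y, |l x - l y| ≤ α * ‖x - y‖) (θ : EuclideanSpace ℝ (Fin d)) :
    HasFDerivAt (smoothedAniso d σ l)
      (∫ z, fderiv ℝ l (θ + z) ∂(anisoGaussMeasure d σ)) θ := by
  have heq : smoothedAniso d σ l = fun x ↦ ∫ z, l (x + z) ∂(anisoGaussMeasure d σ) := by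
    ext x
    rw [integral_anisoGaussMeasure]
    simp [smoothedAniso, mul_comm]
  have hc := hdiff.continuous
  rw [heq]
  refine (hasFDerivAt_integral_of_dominated_loc_of_lip' (bound := fun _ ↦ α) Filter.univ_mem
    (fun x _ ↦ by fun_prop) ?_ ?_ (ae_of_all _ fun z x _ ↦ ?_) (integrable_const _)
    (ae_of_all _ fun z ↦ ?_)).2
  · refine ((integrable_const |l θ|).add
      ((integrable_norm_anisoGaussMeasure hσ).const_mul α)).mono' (by fun_prop)
      (ae_of_all _ fun z ↦ ?_)
    have h := hlip (θ + z) θ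
    rw [add_sub_cancel_left] at h
    simp only [Pi.add_apply, norm_eq_abs]
    linarith [abs_sub_abs_le_abs_sub (l (θ + z)) (l θ)]
  · exact ((measurable_fderiv ℝ l).comp (measurable_const_add θ)).aestronglyMeasurable
  · simpa using hlip (x + z) (θ + z)
  · exact (hasFDerivAt_comp_add_right z).mpr (hdiff (θ + z)).hasFDerivAt

lemma integral_anisoGaussMeasure_translate {F : Type*} [NormedAddCommGroup F] [NormedSpace ℝ F]
    (g : EuclideanSpace ℝ (Fin d) → F) (x : EuclideanSpace ℝ (Fin d)) :
    ∫ z, g (x + z) ∂(anisoGaussMeasure d σ) = ∫ z, anisoGaussDensity d σ (z - x) • g z := by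
  rw [integral_anisoGaussMeasure,
    ← integral_add_left_eq_self (fun z ↦ anisoGaussDensity d σ (z - x) • g z) x]
  simp

lemma norm_gradient_smoothedAniso_sub_le (hσ : ∀ i, 0 < σ i) {α : ℝ} (hα : 0 ≤ α)
    {l : EuclideanSpace ℝ (Fin d) → ℝ} (hdiff : Differentiable ℝ l)
    (hlip : ∀ x y, |l x - l y| ≤ α * ‖x - y‖) (x y : EuclideanSpace ℝ (Fin d)) :
    ‖gradient (smoothedAniso d σ l) x - gradient (smoothedAniso d σ l) y‖ ≤
      α * (√2 / √π * √(∑ i, ((x - y) i / σ i) ^ 2)) := by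
  have hbound : ∀ z, ‖fderiv ℝ l z‖ ≤ α := fun z ↦
    norm_fderiv_le_of_lip' ℝ hα (Filter.Eventually.of_forall fun w ↦ hlip w z)
  have hshift : ∀ x, Integrable fun z ↦ anisoGaussDensity d σ (z - x) := fun x ↦
    integrable_anisoGaussDensity.comp_sub_right x
  have hint : ∀ x, Integrable fun z ↦ anisoGaussDensity d σ (z - x) • fderiv ℝ l z := fun x ↦
    (hshift x).smul_bdd α (measurable_fderiv ℝ l).aestronglyMeasurable
      (ae_of_all _ hbound)
  rw [gradient, gradient, ← map_sub, LinearIsometryEquiv.norm_map,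
    (hasFDerivAt_smoothedAniso hσ hdiff hlip x).fderiv,
    (hasFDerivAt_smoothedAniso hσ hdiff hlip y).fderiv,
    integral_anisoGaussMeasure_translate, integral_anisoGaussMeasure_translate,
    ← integral_sub (hint x) (hint y)]
  calc _ ≤ ∫ z, α * |anisoGaussDensity d σ (z - y) - anisoGaussDensity d σ (z - x)| := by
        refine norm_integral_le_of_norm_le (((hshift y).sub (hshift x)).abs.const_mul α)
          (ae_of_all _ fun z ↦ ?_)
        rw [← sub_smul, norm_smul, mul_comm, norm_eq_abs, abs_sub_comm]
        gcongr
        exact hbound z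
    _ = α * ∫ z, |anisoGaussDensity d σ (z + (x - y)) - anisoGaussDensity d σ z| := by
        rw [integral_const_mul, ← integral_add_right_eq_self
          (fun z ↦ |anisoGaussDensity d σ (z - y) - anisoGaussDensity d σ (z - x)|) x]
        simp [add_sub_assoc]
    _ ≤ _ := by
        gcongr
        exact integral_abs_anisoGaussDensity_translate_sub_le hσ (x - y)

end Density

/-- For differentiable `α`-Lipschitz `l` and `Z ∼ N(0, diag(σ_1², …, σ_d²))`, the gradient
of `l_μ(θ) = E[l(θ + Z)]` satisfies
`‖∇l_μ(x) − ∇l_μ(y)‖ ≤ (√2 α/(σ₋√π))‖x − y‖ ≤ (α/σ₋)‖x − y‖` where `σ₋ = min_i σ_i`;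
in particular `l_μ` is `(α/σ₋)`-smooth. -/
theorem stmt_13 {d : ℕ} (hd : 0 < d) (α : ℝ) (hα : 0 < α)
    (σ : Fin d → ℝ) (hσ : ∀ i, 0 < σ i)
    (l : EuclideanSpace ℝ (Fin d) → ℝ) (hdiff : Differentiable ℝ l)
    (hlip : ∀ x y, |l x - l y| ≤ α * ‖x - y‖) :
    ∀ x y : EuclideanSpace ℝ (Fin d),
      ‖gradient (smoothedAniso d σ l) x - gradient (smoothedAniso d σ l) y‖ ≤
          Real.sqrt 2 * α /
            (Finset.univ.inf' (Finset.univ_nonempty_iff.mpr (Fin.pos_iff_nonempty.mp hd)) σ *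
              Real.sqrt π) * ‖x - y‖ ∧
        ‖gradient (smoothedAniso d σ l) x - gradient (smoothedAniso d σ l) y‖ ≤
          α / Finset.univ.inf' (Finset.univ_nonempty_iff.mpr (Fin.pos_iff_nonempty.mp hd)) σ *
            ‖x - y‖ := by
  intro x y
  set s := Finset.univ.inf' (Finset.univ_nonempty_iff.mpr (Fin.pos_iff_nonempty.mp hd)) σ with hs
  have hs0 : 0 < s := (Finset.lt_inf'_iff _).mpr fun i _ ↦ hσ i
  have hsle : ∀ i, s ≤ σ i := fun i ↦ Finset.inf'_le _ (Finset.mem_univ i)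
  have hweighted : √(∑ i, ((x - y) i / σ i) ^ 2) ≤ ‖x - y‖ / s := by
    rw [sqrt_le_left (by positivity), div_pow, EuclideanSpace.norm_sq_eq, Finset.sum_div]
    refine Finset.sum_le_sum fun i _ ↦ ?_
    rw [div_pow, norm_eq_abs, sq_abs]
    gcongr
    exact hsle i
  have hmain : ‖gradient (smoothedAniso d σ l) x - gradient (smoothedAniso d σ l) y‖ ≤
      √2 * α / (s * √π) * ‖x - y‖ := by
    calc _ ≤ α * (√2 / √π * √(∑ i, ((x - y) i / σ i) ^ 2)) :=
          norm_gradient_smoothedAniso_sub_le hσ hα.le hdiff hlip x y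
      _ ≤ α * (√2 / √π * (‖x - y‖ / s)) := by gcongr
      _ = _ := by ring
  refine ⟨hmain, hmain.trans ?_⟩
  gcongr ?_ * _
  rw [div_le_div_iff₀ (by positivity) hs0]
  have h2π : √2 ≤ √π := sqrt_le_sqrt two_le_pi
  nlinarith [mul_le_mul_of_nonneg_right h2π (mul_pos hα hs0).le]
end

section
/- (Uniform stability of SGD.) Let l : ℝ^d × Ξ → ℝ be a loss such that for every example ξ ∈ Ξ, θ ↦ l(θ; ξ) takes values in [0, 1], is α-Lipschitz, and is β-smooth with respect to the Euclidean norm. Fix a dataset S = (ξ_1, …, ξ_n) ∈ Ξ^n and run stochastic gradient descent for T steps: starting from θ_0, at step t pick an index i_t uniformly at random from {1, …, n} (independently across steps) and set θ_{t+1} = θ_t − η_t ∇_θ l(θ_t; ξ_{i_t}), with a monotonically non-increasing step-size sequence satisfying η_t ≤ c/t for some c > 0. Then SGD is uniformly stable with stability factor ε_s satisfying ε_s ≤ ((1 + 1/(βc))/(n − 1)) · (2cα²)^{1/(βc+1)} · T^{βc/(βc+1)}; that is, for any two datasets S, S' ∈ Ξ^n differing in at most one example, running SGD on both with the same initialization and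 the same random index sequence yields sup_{ξ∈Ξ} E[l(θ_T^S; ξ) − l(θ_T^{S'}; ξ)] ≤ ((1 + 1/(βc))/(n − 1)) (2cα²)^{1/(βc+1)} T^{βc/(βc+1)}, where the expectation is over the random index sequence. -/
open MeasureTheory Real

/-- SGD iterates on dataset `S`: `θ_0 = θ0` and
`θ_{t+1} = θ_t − η_{t+1} ∇_θ l(θ_t; ξ_{seq(t+1)})`, where `seq : Fin T → Fin n` is the
sequence of sampled indices (step `t ∈ {1, …, T}` uses step size `η t` and the example
`S (seq t)`). `sgdFin l η S θ0 T seq` is the iterate `θ_T`. -/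
noncomputable def sgdFin {d n : ℕ} {Ξ : Type*} (l : EuclideanSpace ℝ (Fin d) → Ξ → ℝ)
    (η : ℕ → ℝ) (S : Fin n → Ξ) (θ0 : EuclideanSpace ℝ (Fin d)) :
    (T : ℕ) → (Fin T → Fin n) → EuclideanSpace ℝ (Fin d)
  | 0, _ => θ0
  | T + 1, seq =>
    sgdFin l η S θ0 T (fun t => seq t.castSucc) -
      η (T + 1) •
        gradient (fun θ => l θ (S (seq (Fin.last T))))
          (sgdFin l η S θ0 T (fun t => seq t.castSucc))

open Finset

/-- Bernoulli's inequality for a negative exponent. -/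
lemma one_add_mul_one_sub_le_rpow_neg {b r : ℝ} (hb : 0 ≤ b) (hr : 0 < r) :
    1 + b * (1 - r) ≤ r ^ (-b) := by
  rw [Real.rpow_def_of_pos hr]
  have h1 := Real.add_one_le_exp (Real.log r * -b)
  have h2 := Real.log_le_sub_one_of_pos hr
  nlinarith

/-- The tangent-line inequality for the convex function `u ↦ u ^ (-b)` at `v`. -/
lemma rpow_neg_tangent_le {b u v : ℝ} (hb : 0 ≤ b) (hu : 0 < u) (hv : 0 < v) :
    v ^ (-b) + b * (v - u) * v ^ (-b - 1) ≤ u ^ (-b) := by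
  have h := one_add_mul_one_sub_le_rpow_neg hb (div_pos hu hv)
  have hvb : 0 < v ^ (-b) := Real.rpow_pos_of_pos hv _
  rw [Real.div_rpow hu.le hv.le, le_div_iff₀ hvb] at h
  rw [Real.rpow_sub_one hv.ne']
  calc _ = (1 + b * (1 - u / v)) * v ^ (-b) := by field_simp
    _ ≤ _ := h

/-- Comparison of the sum of `min 1 ((x / s) ^ (b + 1))` with the corresponding integral. -/
lemma sum_min_one_rpow_le {b x : ℝ} (hb : 0 < b) (hx : 0 < x) (N : ℕ) :
    ∑ s ∈ range N, min 1 (x ^ (b + 1) * ((s : ℝ) + 1) ^ (-b - 1)) ≤ x * (1 + 1 / b) := by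
  have hA : 0 < x ^ (b + 1) := Real.rpow_pos_of_pos hx _
  have hAx : x ^ (b + 1) * x ^ (-b) = x := by
    rw [← Real.rpow_add hx]; simp
  suffices h : ((N : ℝ) ≤ x →
      ∑ s ∈ range N, min 1 (x ^ (b + 1) * ((s : ℝ) + 1) ^ (-b - 1)) ≤ N) ∧
      (x < N → ∑ s ∈ range N, min 1 (x ^ (b + 1) * ((s : ℝ) + 1) ^ (-b - 1)) ≤
        x + x ^ (b + 1) / b * (x ^ (-b) - (N : ℝ) ^ (-b))) by
    rcases le_or_gt (N : ℝ) x with hN | hN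
    · refine (h.1 hN).trans (hN.trans ?_)
      have : 0 < x * (1 / b) := by positivity
      linarith
    · refine (h.2 hN).trans ?_
      have h1 : 0 < x ^ (b + 1) / b * (N : ℝ) ^ (-b) :=
        mul_pos (div_pos hA hb) (Real.rpow_pos_of_pos (hx.trans hN) _)
      have h2 : x ^ (b + 1) / b * x ^ (-b) = x * (1 / b) := by
        rw [div_mul_eq_mul_div, hAx]; ring
      linarith
  induction N with
  | zero => exact ⟨fun _ => by simp, fun h => absurd h (by simpa using hx.le)⟩
  | succ N ih =>
    rw [sum_range_succ]
    push_cast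
    have hv : (0 : ℝ) < N + 1 := by positivity
    have tangent : ∀ u : ℝ, 0 < u →
        x ^ (b + 1) * (((N : ℝ) + 1 - u) * ((N : ℝ) + 1) ^ (-b - 1)) ≤
          x ^ (b + 1) / b * (u ^ (-b) - ((N : ℝ) + 1) ^ (-b)) := by
      intro u hu
      have h := rpow_neg_tangent_le hb.le hu hv
      rw [div_mul_eq_mul_div, mul_div_assoc]
      refine mul_le_mul_of_nonneg_left ?_ hA.le
      rw [le_div_iff₀ hb]
      linarith
    refine ⟨fun h => ?_, fun h => ?_⟩
    · have := ih.1 (by linarith)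
      have := min_le_left (1 : ℝ) (x ^ (b + 1) * ((N : ℝ) + 1) ^ (-b - 1))
      linarith
    · have hmin := min_le_right (1 : ℝ) (x ^ (b + 1) * ((N : ℝ) + 1) ^ (-b - 1))
      rcases le_or_gt (N : ℝ) x with hN | hN
      · have h0 := ih.1 hN
        have h1 := tangent x hx
        have h2 : x ^ (b + 1) * ((N : ℝ) + 1) ^ (-b - 1) ≤ 1 := by
          calc _ ≤ x ^ (b + 1) * x ^ (-b - 1) :=
                mul_le_mul_of_nonneg_left
                  (Real.rpow_le_rpow_of_nonpos hx h.le (by linarith)) hA.le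
            _ = 1 := by rw [← Real.rpow_add hx]; simp
        nlinarith
      · have h0 := ih.2 hN
        have h1 := tangent N (hx.trans hN)
        have h2 : ((N : ℝ) + 1 - N) = 1 := by ring
        rw [h2, one_mul] at h1
        linarith

lemma min_one_add_le {a b : ℝ} (ha : 0 ≤ a) (hb : 0 ≤ b) :
    min 1 (a + b) ≤ min 1 a + min 1 b := by
  rcases le_total 1 a with h | h
  · rw [min_eq_left h]
    exact (min_le_left _ _).trans (by linarith [le_min zero_le_one hb])
  · rcases le_total 1 b with h' | h'
    · rw [min_eq_left h']
      exact (min_le_left _ _).trans (by linarith [le_min zero_le_one ha])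
    · rw [min_eq_right h, min_eq_right h']
      exact min_le_right _ _

lemma norm_gradient_le_of_lipschitz {E : Type*} [NormedAddCommGroup E] [InnerProductSpace ℝ E]
    [CompleteSpace E] {f : E → ℝ} {α : ℝ} (hα : 0 ≤ α)
    (hf : ∀ x y, |f x - f y| ≤ α * ‖x - y‖) (x : E) : ‖gradient f x‖ ≤ α := by
  have hL : LipschitzWith ⟨α, hα⟩ f :=
    LipschitzWith.of_dist_le_mul fun x y => by
      rw [Real.dist_eq, dist_eq_norm]; exact hf x y
  rw [gradient, LinearIsometryEquiv.norm_map]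
  exact norm_fderiv_le_of_lipschitz ℝ hL

section

variable {d n : ℕ} {Ξ : Type*} {α β c : ℝ} {l : EuclideanSpace ℝ (Fin d) → Ξ → ℝ}
  {η : ℕ → ℝ} {S S' : Fin n → Ξ} {j : Fin n}

lemma sgdFin_snoc (S : Fin n → Ξ) (θ0 : EuclideanSpace ℝ (Fin d)) (T : ℕ) (i : Fin n)
    (seq : Fin T → Fin n) :
    sgdFin l η S θ0 (T + 1) (Fin.snoc (α := fun _ => Fin n) seq i) =
      sgdFin l η S θ0 T seq -
        η (T + 1) • gradient (fun θ => l θ (S i)) (sgdFin l η S θ0 T seq) := by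
  simp [sgdFin]

/-- One step of SGD on the same example expands distances by at most `1 + β η`. -/
lemma norm_step_sub_step_le_of_smooth {E : Type*} [NormedAddCommGroup E] [NormedSpace ℝ E]
    {x y g h : E} {t : ℝ} (ht : 0 ≤ t) (hgh : ‖g - h‖ ≤ β * ‖x - y‖) :
    ‖(x - t • g) - (y - t • h)‖ ≤ (1 + β * t) * ‖x - y‖ := by
  have e : (x - t • g) - (y - t • h) = (x - y) - t • (g - h) := by
    rw [smul_sub]; abel
  rw [e]
  refine (norm_sub_le _ _).trans ?_
  rw [norm_smul, Real.norm_of_nonneg ht]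
  nlinarith [mul_le_mul_of_nonneg_left hgh ht]

/-- One step of SGD with gradients bounded by `α` moves two points apart by at most `2 α η`. -/
lemma norm_step_sub_step_le_of_bounded {E : Type*} [NormedAddCommGroup E] [NormedSpace ℝ E]
    {x y g h : E} {t : ℝ} (ht : 0 ≤ t) (hg : ‖g‖ ≤ α) (hh : ‖h‖ ≤ α) :
    ‖(x - t • g) - (y - t • h)‖ ≤ ‖x - y‖ + 2 * α * t := by
  have e : (x - t • g) - (y - t • h) = (x - y) - t • (g - h) := by
    rw [smul_sub]; abel
  rw [e]
  refine (norm_sub_le _ _).trans ?_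
  rw [norm_smul, Real.norm_of_nonneg ht]
  nlinarith [mul_le_mul_of_nonneg_left ((norm_sub_le g h).trans (add_le_add hg hh)) ht]

/-- One-step recursion for the sum over index sequences of the truncated distance between the
two SGD iterates. -/
lemma sum_min_one_dist_succ_le (hα : 0 ≤ α) (hβ : 0 ≤ β)
    (hlip : ∀ ξ x y, |l x ξ - l y ξ| ≤ α * ‖x - y‖)
    (hsmooth : ∀ ξ x y,
      ‖gradient (fun θ => l θ ξ) x - gradient (fun θ => l θ ξ) y‖ ≤ β * ‖x - y‖)
    (hη : ∀ t, 0 ≤ η t) (hj : ∀ i, i ≠ j → S i = S' i)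
    (θ0 : EuclideanSpace ℝ (Fin d)) (T : ℕ) {L : ℝ} (hL : 0 ≤ L) :
    ∑ seq : Fin (T + 1) → Fin n,
        min 1 (L * ‖sgdFin l η S θ0 (T + 1) seq - sgdFin l η S' θ0 (T + 1) seq‖) ≤
      n * ∑ seq : Fin T → Fin n, min 1 (L * (1 + β * η (T + 1)) *
          ‖sgdFin l η S θ0 T seq - sgdFin l η S' θ0 T seq‖) +
        (n : ℝ) ^ T * min 1 (L * (2 * α * η (T + 1))) := by
  have ht := hη (T + 1)
  have key : ∀ (i : Fin n) (seq : Fin T → Fin n),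
      min 1 (L * ‖sgdFin l η S θ0 (T + 1) (Fin.snoc (α := fun _ => Fin n) seq i) -
          sgdFin l η S' θ0 (T + 1) (Fin.snoc (α := fun _ => Fin n) seq i)‖) ≤
        min 1 (L * (1 + β * η (T + 1)) *
          ‖sgdFin l η S θ0 T seq - sgdFin l η S' θ0 T seq‖) +
        if i = j then min 1 (L * (2 * α * η (T + 1))) else 0 := by
    intro i seq
    rw [sgdFin_snoc, sgdFin_snoc]
    split_ifs with hi
    · have h := norm_step_sub_step_le_of_bounded (x := sgdFin l η S θ0 T seq)
        (y := sgdFin l η S' θ0 T seq) ht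
        (norm_gradient_le_of_lipschitz hα (hlip (S i)) (sgdFin l η S θ0 T seq))
        (norm_gradient_le_of_lipschitz hα (hlip (S' i)) (sgdFin l η S' θ0 T seq))
      refine le_trans ?_ (min_one_add_le (by positivity) (by positivity))
      refine min_le_min_left _ ((mul_le_mul_of_nonneg_left h hL).trans ?_)
      have : 0 ≤ L * (β * η (T + 1)) *
        ‖sgdFin l η S θ0 T seq - sgdFin l η S' θ0 T seq‖ := by positivity
      linarith
    · rw [add_zero, ← hj i hi, mul_assoc]
      exact min_le_min_left _ (mul_le_mul_of_nonneg_left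
        (norm_step_sub_step_le_of_smooth ht (hsmooth _ _ _)) hL)
  rw [← (Fin.snocEquiv fun _ => Fin n).sum_comp, Fintype.sum_prod_type]
  calc _ ≤ ∑ i : Fin n, ∑ seq : Fin T → Fin n, (min 1 (L * (1 + β * η (T + 1)) *
          ‖sgdFin l η S θ0 T seq - sgdFin l η S' θ0 T seq‖) +
        if i = j then min 1 (L * (2 * α * η (T + 1))) else 0) :=
        sum_le_sum fun i _ => sum_le_sum fun seq _ => key i seq
    _ = _ := by simp [sum_add_distrib]

/-- The sum over index sequences of the truncated distance between the two SGD iterates. -/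
lemma sum_min_one_dist_le (hα : 0 ≤ α) (hβ : 0 ≤ β) (hc : 0 ≤ c)
    (hlip : ∀ ξ x y, |l x ξ - l y ξ| ≤ α * ‖x - y‖)
    (hsmooth : ∀ ξ x y,
      ‖gradient (fun θ => l θ ξ) x - gradient (fun θ => l θ ξ) y‖ ≤ β * ‖x - y‖)
    (hηpos : ∀ t, 0 ≤ η t) (hη : ∀ t : ℕ, 1 ≤ t → η t ≤ c / t)
    (hj : ∀ i, i ≠ j → S i = S' i) (θ0 : EuclideanSpace ℝ (Fin d)) (T : ℕ) {L : ℝ}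
    (hL : 0 ≤ L) :
    ∑ seq : Fin T → Fin n, min 1 (L * ‖sgdFin l η S θ0 T seq - sgdFin l η S' θ0 T seq‖) ≤
      (n : ℝ) ^ T / n * ∑ s ∈ range T,
        min 1 (L * (2 * α * c) * (T : ℝ) ^ (β * c) * ((s : ℝ) + 1) ^ (-(β * c) - 1)) := by
  have hn : (0 : ℝ) < n := by exact_mod_cast j.pos
  induction T generalizing L with
  | zero => simp [sgdFin]
  | succ T ih =>
    have hb : 0 ≤ β * c := mul_nonneg hβ hc
    have hT : (0 : ℝ) < T + 1 := by positivity
    have hηT : η (T + 1) ≤ c / (T + 1) := by exact_mod_cast hη (T + 1) (by omega)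
    have hfac : 0 ≤ 1 + β * η (T + 1) := by
      have := hηpos (T + 1)
      positivity
    have hgrow : ∀ s ∈ range T, (1 + β * η (T + 1)) * (T : ℝ) ^ (β * c) ≤
        ((T : ℝ) + 1) ^ (β * c) := by
      intro s hs
      have hT0 : (0 : ℝ) < T := by
        exact_mod_cast (Nat.zero_le s).trans_lt (mem_range.1 hs)
      have h1 := one_add_mul_one_sub_le_rpow_neg hb (div_pos hT0 hT)
      have h2 : 1 + β * η (T + 1) ≤ 1 + β * c * (1 - (T : ℝ) / (T + 1)) := by
        have e : β * c * (1 - (T : ℝ) / (T + 1)) = β * (c / (T + 1)) := by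
          field_simp; ring
        rw [e]
        linarith [mul_le_mul_of_nonneg_left hηT hβ]
      have h3 := h2.trans h1
      rw [Real.rpow_neg (by positivity), Real.div_rpow hT0.le hT.le, inv_div,
        le_div_iff₀ (Real.rpow_pos_of_pos hT0 _)] at h3
      exact h3
    have hold : ∑ s ∈ range T, min 1 (L * (1 + β * η (T + 1)) * (2 * α * c) *
          (T : ℝ) ^ (β * c) * ((s : ℝ) + 1) ^ (-(β * c) - 1)) ≤
        ∑ s ∈ range T, min 1 (L * (2 * α * c) * ((T : ℝ) + 1) ^ (β * c) *
          ((s : ℝ) + 1) ^ (-(β * c) - 1)) := by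
      refine sum_le_sum fun s hs => min_le_min_left _ ?_
      refine mul_le_mul_of_nonneg_right ?_ (by positivity)
      calc _ = L * (2 * α * c) * ((1 + β * η (T + 1)) * (T : ℝ) ^ (β * c)) := by ring
        _ ≤ _ := mul_le_mul_of_nonneg_left (hgrow s hs) (by positivity)
    have hnew : min 1 (L * (2 * α * η (T + 1))) ≤
        min 1 (L * (2 * α * c) * ((T : ℝ) + 1) ^ (β * c) *
          ((T : ℝ) + 1) ^ (-(β * c) - 1)) := by
      refine min_le_min_left _ ?_
      have e : β * c + (-(β * c) - 1) = -1 := by ring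
      rw [mul_assoc _ (_ ^ _), ← Real.rpow_add hT, e, Real.rpow_neg_one]
      calc L * (2 * α * η (T + 1)) ≤ L * (2 * α * (c / (T + 1))) := by gcongr
        _ = _ := by ring
    refine (sum_min_one_dist_succ_le hα hβ hlip hsmooth hηpos hj θ0 T hL).trans ?_
    rw [sum_range_succ]
    push_cast
    have h := (ih (mul_nonneg hL hfac)).trans
      (mul_le_mul_of_nonneg_left hold (by positivity))
    calc _ ≤ n * ((n : ℝ) ^ T / n * ∑ s ∈ range T, min 1 (L * (2 * α * c) *
            ((T : ℝ) + 1) ^ (β * c) * ((s : ℝ) + 1) ^ (-(β * c) - 1))) +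
          (n : ℝ) ^ T * min 1 (L * (2 * α * c) * ((T : ℝ) + 1) ^ (β * c) *
            ((T : ℝ) + 1) ^ (-(β * c) - 1)) := by gcongr
      _ = _ := by rw [pow_succ]; field_simp

end

/-- Uniform stability of SGD (Hardt et al.): for a loss in `[0,1]` that is `α`-Lipschitz and
`β`-smooth in `θ`, running `T` steps of SGD with non-increasing step sizes `η_t ≤ c/t` on two
datasets differing in at most one example, with shared initialization and shared uniformly
random index sequence, gives
`E[l(θ_T^S; ξ) − l(θ_T^{S'}; ξ)] ≤ ((1 + 1/(βc))/(n−1)) (2cα²)^{1/(βc+1)} T^{βc/(βc+1)}`. -/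
theorem stmt_16 {d n : ℕ} {Ξ : Type*} (hn : 2 ≤ n)
    (α β c : ℝ) (hα : 0 < α) (hβ : 0 < β) (hc : 0 < c)
    (l : EuclideanSpace ℝ (Fin d) → Ξ → ℝ)
    (hrange : ∀ θ ξ, l θ ξ ∈ Set.Icc (0 : ℝ) 1)
    (hdiff : ∀ ξ, Differentiable ℝ (fun θ => l θ ξ))
    (hlip : ∀ ξ x y, |l x ξ - l y ξ| ≤ α * ‖x - y‖)
    (hsmooth : ∀ ξ x y,
      ‖gradient (fun θ => l θ ξ) x - gradient (fun θ => l θ ξ) y‖ ≤ β * ‖x - y‖)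
    (η : ℕ → ℝ) (hηpos : ∀ t, 0 ≤ η t) (hmono : ∀ s t, s ≤ t → η t ≤ η s)
    (hη : ∀ t : ℕ, 1 ≤ t → η t ≤ c / t)
    (T : ℕ) (θ0 : EuclideanSpace ℝ (Fin d))
    (S S' : Fin n → Ξ) (hSS' : ∃ j, ∀ i, i ≠ j → S i = S' i) (ξ : Ξ) :
    (∑ seq : Fin T → Fin n, (l (sgdFin l η S θ0 T seq) ξ - l (sgdFin l η S' θ0 T seq) ξ)) /
        (n : ℝ) ^ T ≤
      (1 + 1 / (β * c)) / ((n : ℝ) - 1) * (2 * c * α ^ 2) ^ ((1 : ℝ) / (β * c + 1)) *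
        (T : ℝ) ^ (β * c / (β * c + 1)) := by
  obtain ⟨j, hj⟩ := hSS'
  have hb : 0 < β * c := mul_pos hβ hc
  have hn1 : (0 : ℝ) < (n : ℝ) - 1 := by
    have : (2 : ℝ) ≤ n := by exact_mod_cast hn
    linarith
  have hn0 : (0 : ℝ) < n := by linarith
  rcases Nat.eq_zero_or_pos T with rfl | hT
  · simp only [sgdFin, sub_self, sum_const_zero, zero_div]
    positivity
  have hT0 : (0 : ℝ) < T := by exact_mod_cast hT
  set x : ℝ := (2 * c * α ^ 2) ^ ((1 : ℝ) / (β * c + 1)) * (T : ℝ) ^ (β * c / (β * c + 1))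
    with hx
  have hx0 : 0 < x := by positivity
  have hxpow : x ^ (β * c + 1) = α * (2 * α * c) * (T : ℝ) ^ (β * c) := by
    rw [hx, Real.mul_rpow (by positivity) (by positivity), ← Real.rpow_mul (by positivity),
      ← Real.rpow_mul (by positivity), div_mul_cancel₀ _ (by positivity),
      div_mul_cancel₀ _ (by positivity), Real.rpow_one]
    ring
  have hloss : ∀ seq : Fin T → Fin n,
      l (sgdFin l η S θ0 T seq) ξ - l (sgdFin l η S' θ0 T seq) ξ ≤
        min 1 (α * ‖sgdFin l η S θ0 T seq - sgdFin l η S' θ0 T seq‖) := fun seq =>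
    le_min (by linarith [(hrange (sgdFin l η S θ0 T seq) ξ).2,
      (hrange (sgdFin l η S' θ0 T seq) ξ).1]) ((le_abs_self _).trans (hlip ξ _ _))
  have hsum := sum_min_one_dist_le hα.le hβ.le hc.le hlip hsmooth hηpos hη hj θ0 T hα.le
  rw [← hxpow] at hsum
  have hbound := (sum_le_sum fun seq _ => hloss seq).trans (hsum.trans
    (mul_le_mul_of_nonneg_left (sum_min_one_rpow_le hb hx0 T) (by positivity)))
  rw [mul_assoc, ← hx, div_le_iff₀ (by positivity)]
  refine hbound.trans ?_
  calc (n : ℝ) ^ T / n * (x * (1 + 1 / (β * c)))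
      ≤ (n : ℝ) ^ T / ((n : ℝ) - 1) * (x * (1 + 1 / (β * c))) := by
        gcongr
        linarith
    _ = _ := by ring
end
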